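/- Let β > 0 and let k satisfy 3/(3+β) < k < 4/(4+β). Then Q⁺⁻(k) = {(x,y,z) ∈ ℝ³ : β(x²y²+y²z²+z²x²) + (x²+y²+z²−1/2)² − (1−k)/4 = 0} is a nonempty compact connected set. -/

import Mathlib

/-- The cone over the directions whose rays meet the quartic `Q⁺⁻(k)`. -/
def quarticCone (β k : ℝ) : Set (EuclideanSpace ℝ (Fin 3)) :=
  {p | 0 < (p 0)^2 + (p 1)^2 + (p 2)^2 ∧
    k * (((p 0)^2 + (p 1)^2 + (p 2)^2)^2
      + β * ((p 0)^2*(p 1)^2 + (p 1)^2*(p 2)^2 + (p 2)^2*(p 0)^2))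
      ≤ ((p 0)^2 + (p 1)^2 + (p 2)^2)^2}

/-- A coordinate plane with the origin removed. -/
def puncturedPlane (i : Fin 3) : Set (EuclideanSpace ℝ (Fin 3)) :=
  {p | 0 < (p 0)^2 + (p 1)^2 + (p 2)^2 ∧ p i = 0}

lemma sq_re_add_sq_im_pos {z : ℂ} (hz : z ≠ 0) : 0 < z.re ^ 2 + z.im ^ 2 := by
  have := Complex.normSq_pos.2 hz
  rw [Complex.normSq_apply] at this
  nlinarith

lemma isPreconnected_puncturedPlane (i : Fin 3) : IsPreconnected (puncturedPlane i) := by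
  have hC : IsPreconnected ({0}ᶜ : Set ℂ) :=
    (isConnected_compl_singleton_of_one_lt_rank (by simp [Complex.rank_real_complex]) 0).isPreconnected
  have key : ∀ (f : ℂ → EuclideanSpace ℝ (Fin 3)), Continuous f →
      f '' {0}ᶜ = puncturedPlane i → IsPreconnected (puncturedPlane i) :=
    fun f hf h => h ▸ hC.image f hf.continuousOn
  fin_cases i
  · refine key (fun z => !₂[0, z.re, z.im]) (by fun_prop) ?_
    ext p
    constructor
    · rintro ⟨z, hz, rfl⟩
      simpa [puncturedPlane] using sq_re_add_sq_im_pos hz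
    · rintro ⟨h, h0⟩
      simp only [Fin.zero_eta] at h0
      refine ⟨⟨p 1, p 2⟩, fun hz => ?_, ?_⟩
      · simp [Complex.ext_iff] at hz
        simp [h0, hz.1, hz.2] at h
      · ext j; fin_cases j <;> simp [h0]
  · refine key (fun z => !₂[z.re, 0, z.im]) (by fun_prop) ?_
    ext p
    constructor
    · rintro ⟨z, hz, rfl⟩
      simpa [puncturedPlane] using sq_re_add_sq_im_pos hz
    · rintro ⟨h, h0⟩
      simp only [Fin.mk_one] at h0
      refine ⟨⟨p 0, p 2⟩, fun hz => ?_, ?_⟩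
      · simp [Complex.ext_iff] at hz
        simp [h0, hz.1, hz.2] at h
      · ext j; fin_cases j <;> simp [h0]
  · refine key (fun z => !₂[z.re, z.im, 0]) (by fun_prop) ?_
    ext p
    constructor
    · rintro ⟨z, hz, rfl⟩
      simpa [puncturedPlane] using sq_re_add_sq_im_pos hz
    · rintro ⟨h, h0⟩
      simp only [Fin.reduceFinMk] at h0
      refine ⟨⟨p 0, p 1⟩, fun hz => ?_, ?_⟩
      · simp [Complex.ext_iff] at hz
        simp [h0, hz.1, hz.2] at h
      · ext j; fin_cases j <;> simp [h0]

lemma isPreconnected_iUnion_puncturedPlane : IsPreconnected (⋃ i, puncturedPlane i) := by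
  have h01 : IsPreconnected (puncturedPlane 0 ∪ puncturedPlane 1) :=
    (isPreconnected_puncturedPlane 0).union !₂[0, 0, 1] (by simp [puncturedPlane])
      (by simp [puncturedPlane]) (isPreconnected_puncturedPlane 1)
  have h012 : IsPreconnected ((puncturedPlane 0 ∪ puncturedPlane 1) ∪ puncturedPlane 2) :=
    h01.union !₂[0, 1, 0] (Or.inl (by simp [puncturedPlane]))
      (by simp [puncturedPlane]) (isPreconnected_puncturedPlane 2)
  convert h012 using 1
  ext p
  simp [Fin.exists_fin_succ, or_assoc]

lemma puncturedPlane_subset_quarticCone {β k : ℝ} (hβ : 0 < β) (hk : 0 < k)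
    (hk1 : k * (4 + β) < 4) (i : Fin 3) : puncturedPlane i ⊆ quarticCone β k := by
  have key : ∀ a b : ℝ, k * ((a ^ 2 + b ^ 2) ^ 2 + β * (a ^ 2 * b ^ 2)) ≤ (a ^ 2 + b ^ 2) ^ 2 := by
    intro a b
    have h1 := mul_nonneg (mul_pos hk hβ).le (sq_nonneg (a ^ 2 - b ^ 2))
    have h2 := mul_nonneg (sub_nonneg.2 hk1.le) (sq_nonneg (a ^ 2 + b ^ 2))
    nlinarith
  rintro p ⟨h, h0⟩
  refine ⟨h, ?_⟩
  fin_cases i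
  · simp only [Fin.zero_eta] at h0
    have := key (p 1) (p 2)
    rw [h0]; ring_nf at this ⊢; exact this
  · simp only [Fin.mk_one] at h0
    have := key (p 2) (p 0)
    rw [h0]; ring_nf at this ⊢; exact this
  · simp only [Fin.reduceFinMk] at h0
    have := key (p 0) (p 1)
    rw [h0]; ring_nf at this ⊢; exact this

/-- Shrinking the smallest of `a, b, c` decreases `(ab + bc + ca) / (a + b + c)²`. -/
lemma cone_ineq_of_shrink {β k a b c d : ℝ} (hβ : 0 < β) (hk : 0 < k)
    (hd : 0 ≤ d) (hdc : d ≤ c) (hca : c ≤ a) (hcb : c ≤ b) (hu : 0 < a + b + c)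
    (h : k * ((a + b + c) ^ 2 + β * (a * b + b * c + c * a)) ≤ (a + b + c) ^ 2) :
    0 < a + b + d ∧
      k * ((a + b + d) ^ 2 + β * (a * b + b * d + d * a)) ≤ (a + b + d) ^ 2 := by
  refine ⟨by linarith, ?_⟩
  have hmono : (a * b + b * d + d * a) * (a + b + c) ^ 2
      ≤ (a * b + b * c + c * a) * (a + b + d) ^ 2 := by
    have hfac : (a * b + b * c + c * a) * (a + b + d) ^ 2
        - (a * b + b * d + d * a) * (a + b + c) ^ 2
        = (c - d) * ((a + b) * (a - b) ^ 2 + (a + b) * (a * b - c * d)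
          + a * b * ((a + b) - (c + d))) := by
      ring
    have hcd : c * d ≤ a * b := mul_le_mul hca (hdc.trans hcb) hd (by linarith)
    have ha : 0 ≤ a := by linarith
    have hb : 0 ≤ b := by linarith
    have hfac_nonneg : 0 ≤ (c - d) * ((a + b) * (a - b) ^ 2 + (a + b) * (a * b - c * d)
          + a * b * ((a + b) - (c + d))) := by
      have hcd' : 0 ≤ a * b - c * d := sub_nonneg.2 hcd
      have hs : 0 ≤ (a + b) - (c + d) := by linarith
      have hc : 0 ≤ c - d := sub_nonneg.2 hdc
      positivity
    linarith
  have h1 := mul_le_mul_of_nonneg_left hmono (mul_pos hk hβ).le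
  have h2 := mul_le_mul_of_nonneg_right h (sq_nonneg (a + b + d))
  have h3 : 0 < (a + b + c) ^ 2 := by positivity
  refine le_of_mul_le_mul_right ?_ h3
  nlinarith

lemma isPreconnected_quarticCone {β k : ℝ} (hβ : 0 < β) (hk : 0 < k)
    (hk1 : k * (4 + β) < 4) : IsPreconnected (quarticCone β k) := by
  refine isPreconnected_of_forall !₂[1, 0, 0] fun p hp => ?_
  obtain ⟨i, hi⟩ := Finite.exists_min fun j => (p j) ^ 2
  set γ : ℝ → EuclideanSpace ℝ (Fin 3) :=
    fun τ => WithLp.toLp 2 (Function.update (fun j => p j) i (τ * p i)) with hγ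
  have hγc : Continuous γ := by
    refine (PiLp.continuous_toLp 2 _).comp ?_
    exact continuous_const.update i (by fun_prop)
  have hγmem : ∀ τ ∈ Set.Icc (0 : ℝ) 1, γ τ ∈ quarticCone β k := by
    intro τ hτ
    have hτ2 : τ ^ 2 ≤ 1 := pow_le_one₀ hτ.1 hτ.2
    have hd : (τ * p i) ^ 2 ≤ (p i) ^ 2 := by
      rw [mul_pow]; exact mul_le_of_le_one_left (sq_nonneg _) hτ2
    obtain ⟨hu, hle⟩ := hp
    have key := fun j l hu h => cone_ineq_of_shrink (β := β) (k := k) hβ hk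
      (sq_nonneg (τ * p i)) hd (hi j) (hi l) hu h
    fin_cases i
    · obtain ⟨h1, h2⟩ := key 1 2 (by simp; linarith)
        (by simp only [Fin.zero_eta]; ring_nf at hle ⊢; exact hle)
      simp only [quarticCone, hγ, Set.mem_ofPred_eq]
      simp at h1 h2 ⊢
      constructor
      · linarith
      · ring_nf at h2 ⊢; exact h2
    · obtain ⟨h1, h2⟩ := key 2 0 (by simp; linarith)
        (by simp only [Fin.mk_one]; ring_nf at hle ⊢; exact hle)
      simp only [quarticCone, hγ, Set.mem_ofPred_eq]
      simp at h1 h2 ⊢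
      constructor
      · linarith
      · ring_nf at h2 ⊢; exact h2
    · obtain ⟨h1, h2⟩ := key 0 1 (by simp; linarith)
        (by simp only [Fin.reduceFinMk]; ring_nf at hle ⊢; exact hle)
      simp only [quarticCone, hγ, Set.mem_ofPred_eq]
      simp at h1 h2 ⊢
      constructor
      · linarith
      · ring_nf at h2 ⊢; exact h2
  have hγ0 : γ 0 ∈ ⋃ i, puncturedPlane i :=
    Set.mem_iUnion.2 ⟨i, (hγmem 0 (by simp)).1, by simp [hγ]⟩
  have hγ1 : γ 1 = p := by
    ext j; simp [hγ]
  refine ⟨(⋃ i, puncturedPlane i) ∪ γ '' Set.Icc 0 1, ?_, Or.inl ?_, Or.inr ⟨1, by simp, hγ1⟩, ?_⟩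
  · exact Set.union_subset
      (Set.iUnion_subset fun i => puncturedPlane_subset_quarticCone hβ hk hk1 i)
      (Set.image_subset_iff.2 hγmem)
  · exact Set.mem_iUnion.2 ⟨1, by simp [puncturedPlane]⟩
  · exact isPreconnected_iUnion_puncturedPlane.union (γ 0) hγ0 ⟨0, by simp, rfl⟩
      (isPreconnected_Icc.image γ hγc.continuousOn)

/-- The squared factor by which a point of the cone is rescaled onto the quartic; the two choices
`σ = 1` and `σ = -1` give the outer and the inner sheet. -/
noncomputable def quarticScale (β k σ : ℝ) (p : EuclideanSpace ℝ (Fin 3)) : ℝ :=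
  ((p 0)^2 + (p 1)^2 + (p 2)^2 + σ * √(((p 0)^2 + (p 1)^2 + (p 2)^2)^2
    - k * (((p 0)^2 + (p 1)^2 + (p 2)^2)^2
      + β * ((p 0)^2*(p 1)^2 + (p 1)^2*(p 2)^2 + (p 2)^2*(p 0)^2))))
  / (2 * (((p 0)^2 + (p 1)^2 + (p 2)^2)^2
      + β * ((p 0)^2*(p 1)^2 + (p 1)^2*(p 2)^2 + (p 2)^2*(p 0)^2)))

/-- The quartic `Q⁺⁻(k)`. -/
def quartic (β k : ℝ) : Set (EuclideanSpace ℝ (Fin 3)) :=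
  {p | β * ((p 0)^2*(p 1)^2 + (p 1)^2*(p 2)^2 + (p 2)^2*(p 0)^2)
        + ((p 0)^2 + (p 1)^2 + (p 2)^2 - 1/2)^2 - (1 - k)/4 = 0}

/-- The radial projection of the cone onto a sheet of the quartic. -/
noncomputable def quarticSheet (β k σ : ℝ) (p : EuclideanSpace ℝ (Fin 3)) :
    EuclideanSpace ℝ (Fin 3) :=
  √(quarticScale β k σ p) • p

lemma continuousOn_quarticSheet {β : ℝ} (k σ : ℝ) (hβ : 0 < β) :
    ContinuousOn (quarticSheet β k σ) (quarticCone β k) := by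
  refine ContinuousOn.smul (ContinuousOn.sqrt (ContinuousOn.div (by fun_prop) (by fun_prop) ?_))
    continuousOn_id
  rintro p ⟨hu, -⟩
  positivity

lemma quarticSheet_mem {β k σ : ℝ} (hβ : 0 < β) (hk : 0 < k) (hσ : σ ^ 2 = 1)
    {p : EuclideanSpace ℝ (Fin 3)} (hp : p ∈ quarticCone β k) :
    quarticSheet β k σ p ∈ quartic β k := by
  obtain ⟨hu, hle⟩ := hp
  set u := (p 0)^2 + (p 1)^2 + (p 2)^2 with hu_def
  set v := (p 0)^2*(p 1)^2 + (p 1)^2*(p 2)^2 + (p 2)^2*(p 0)^2 with hv_def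
  have hv : 0 ≤ v := by positivity
  have hN : 0 < u ^ 2 + β * v := by positivity
  set r := √(u ^ 2 - k * (u ^ 2 + β * v)) with hr_def
  have hr : r ^ 2 = u ^ 2 - k * (u ^ 2 + β * v) := Real.sq_sqrt (by linarith)
  have hs_def : quarticScale β k σ p = (u + σ * r) / (2 * (u ^ 2 + β * v)) := rfl
  set s := quarticScale β k σ p
  have hru : |σ * r| ≤ |u| := by
    refine sq_le_sq.1 ?_
    rw [mul_pow, hσ, hr]
    nlinarith
  have hs : 0 ≤ s := by
    rw [hs_def]
    have := (abs_le.1 (hru.trans_eq (abs_of_pos hu))).1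
    exact div_nonneg (by linarith) (by positivity)
  have hlin : 2 * (u ^ 2 + β * v) * s - u = σ * r := by
    rw [hs_def]; field_simp; ring
  have hquad : (u ^ 2 + β * v) * s ^ 2 - u * s + k / 4 = 0 := by
    have h : (2 * (u ^ 2 + β * v) * s - u) ^ 2 = u ^ 2 - k * (u ^ 2 + β * v) := by
      rw [hlin, mul_pow, hσ, hr, one_mul]
    have : (u ^ 2 + β * v) * ((u ^ 2 + β * v) * s ^ 2 - u * s + k / 4) = 0 := by
      linear_combination h / 4
    exact (mul_eq_zero.1 this).resolve_left hN.ne'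
  have hsq : √s ^ 2 = s := Real.sq_sqrt hs
  simp only [quartic, quarticSheet, Set.mem_ofPred_eq, PiLp.smul_apply, smul_eq_mul, mul_pow]
  change β * ((√s ^ 2 * _) * (√s ^ 2 * _) + (√s ^ 2 * _) * (√s ^ 2 * _)
    + (√s ^ 2 * _) * (√s ^ 2 * _)) + (√s ^ 2 * _ + √s ^ 2 * _ + √s ^ 2 * _ - _) ^ 2 - _ = 0
  rw [hsq]
  rw [hu_def, hv_def] at hquad
  linear_combination hquad

lemma exists_quarticSheet_eq {β k : ℝ} (hβ : 0 < β) (hk : 0 < k)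
    {p : EuclideanSpace ℝ (Fin 3)} (hp : p ∈ quartic β k) :
    p ∈ quarticCone β k ∧ (quarticSheet β k 1 p = p ∨ quarticSheet β k (-1) p = p) := by
  simp only [quartic, Set.mem_ofPred_eq] at hp
  simp only [quarticCone, quarticSheet, quarticScale, Set.mem_ofPred_eq]
  have hu0 : 0 ≤ (p 0)^2 + (p 1)^2 + (p 2)^2 := by positivity
  have hv : 0 ≤ (p 0)^2*(p 1)^2 + (p 1)^2*(p 2)^2 + (p 2)^2*(p 0)^2 := by positivity
  generalize (p 0)^2 + (p 1)^2 + (p 2)^2 = u at *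
  generalize (p 0)^2*(p 1)^2 + (p 1)^2*(p 2)^2 + (p 2)^2*(p 0)^2 = v at *
  have hu : 0 < u := by
    have := mul_nonneg hβ.le hv
    nlinarith
  have hN : 0 < u ^ 2 + β * v := by positivity
  have hsq : (2 * (u ^ 2 + β * v) - u) ^ 2 = u ^ 2 - k * (u ^ 2 + β * v) := by
    linear_combination 4 * (u ^ 2 + β * v) * hp
  have hle : k * (u ^ 2 + β * v) ≤ u ^ 2 := by
    linarith [sq_nonneg (2 * (u ^ 2 + β * v) - u)]
  refine ⟨⟨hu, hle⟩, ?_⟩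
  rw [← hsq, Real.sqrt_sq_eq_abs]
  have hone : ∀ x, x = 2 * (u ^ 2 + β * v) - u →
      √((u + x) / (2 * (u ^ 2 + β * v))) • p = p := by
    rintro x rfl
    rw [add_sub_cancel, div_self (by positivity), Real.sqrt_one, one_smul]
  rcases abs_choice (2 * (u ^ 2 + β * v) - u) with h | h
  · exact Or.inl (hone _ (by rw [h, one_mul]))
  · exact Or.inr (hone _ (by rw [h]; ring))

lemma quartic_eq_union {β k : ℝ} (hβ : 0 < β) (hk : 0 < k) :
    quartic β k = quarticSheet β k 1 '' quarticCone β k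
      ∪ quarticSheet β k (-1) '' quarticCone β k := by
  refine Set.Subset.antisymm (fun p hp => ?_) (Set.union_subset ?_ ?_)
  · obtain ⟨hc, h⟩ := exists_quarticSheet_eq hβ hk hp
    exact h.imp (fun h => ⟨p, hc, h⟩) (fun h => ⟨p, hc, h⟩)
  · rintro _ ⟨p, hp, rfl⟩
    exact quarticSheet_mem hβ hk (by norm_num) hp
  · rintro _ ⟨p, hp, rfl⟩
    exact quarticSheet_mem hβ hk (by norm_num) hp

/-- The two sheets meet along the boundary of the cone. -/
lemma exists_quarticSheet_eq_quarticSheet {β k : ℝ} (hk1 : k * (4 + β) < 4)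
    (hk0 : 3 < k * (3 + β)) :
    ∃ p ∈ quarticCone β k, quarticSheet β k 1 p = quarticSheet β k (-1) p := by
  have hcont : ContinuousOn
      (fun c : ℝ => k * ((2 + c ^ 2) ^ 2 + β * (1 + 2 * c ^ 2)) - (2 + c ^ 2) ^ 2)
      (Set.Icc 0 1) := by fun_prop
  obtain ⟨c, -, hc⟩ := intermediate_value_Icc (zero_le_one' ℝ) hcont
    (show (0 : ℝ) ∈ Set.Icc _ _ from ⟨by norm_num; linarith, by norm_num; linarith⟩)
  have hc' : (1 + 1 + c ^ 2) ^ 2 - k * ((1 + 1 + c ^ 2) ^ 2 + β * (1 + c ^ 2 + c ^ 2)) = 0 := by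
    linear_combination -hc
  refine ⟨!₂[1, 1, c], ⟨?_, ?_⟩, ?_⟩
  · simp; positivity
  · simp; linarith
  · simp [quarticSheet, quarticScale, hc']

lemma isCompact_quartic {β k : ℝ} (hβ : 0 < β) (hk : 0 < k) : IsCompact (quartic β k) := by
  refine Metric.isCompact_of_isClosed_isBounded (isClosed_eq (by fun_prop) continuous_const) ?_
  refine (Metric.isBounded_closedBall (x := 0) (r := 1)).subset fun p hp => ?_
  simp only [quartic, Set.mem_ofPred_eq] at hp
  have hv : 0 ≤ β * ((p 0)^2*(p 1)^2 + (p 1)^2*(p 2)^2 + (p 2)^2*(p 0)^2) := by positivity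
  rw [mem_closedBall_zero_iff, EuclideanSpace.norm_eq, Real.sqrt_le_iff]
  refine ⟨zero_le_one, ?_⟩
  simp only [Fin.sum_univ_three, Real.norm_eq_abs, sq_abs]
  nlinarith

/-- for `β > 0` and `3/(3+β) < k < 4/(4+β)`, the quartic `Q⁺⁻(k)` is a
nonempty compact connected set. -/
theorem stmt_13 (β k : ℝ) (hβ : 0 < β) (hk0 : 3/(3+β) < k) (hk1 : k < 4/(4+β))
    (Q : Set (EuclideanSpace ℝ (Fin 3)))
    (hQ : Q = {p | β * ((p 0)^2*(p 1)^2 + (p 1)^2*(p 2)^2 + (p 2)^2*(p 0)^2)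
        + ((p 0)^2 + (p 1)^2 + (p 2)^2 - 1/2)^2 - (1 - k)/4 = 0}) :
    Q.Nonempty ∧ IsCompact Q ∧ IsConnected Q := by
  have hk : 0 < k := lt_trans (by positivity) hk0
  rw [div_lt_iff₀ (by positivity)] at hk0
  rw [lt_div_iff₀ (by positivity)] at hk1
  obtain ⟨p, hp, hpp⟩ := exists_quarticSheet_eq_quarticSheet hk1 hk0
  have hQ' : Q = quartic β k := hQ
  have hne : (quartic β k).Nonempty := ⟨_, quarticSheet_mem hβ hk (by norm_num : (1 : ℝ) ^ 2 = 1) hp⟩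
  have hC := isPreconnected_quarticCone hβ hk hk1
  rw [hQ']
  refine ⟨hne, isCompact_quartic hβ hk, hne, ?_⟩
  rw [quartic_eq_union hβ hk]
  exact (hC.image _ (continuousOn_quarticSheet k 1 hβ)).union (quarticSheet β k 1 p)
    ⟨p, hp, rfl⟩ ⟨p, hp, hpp.symm⟩ (hC.image _ (continuousOn_quarticSheet k (-1) hβ))
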